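/- arXiv:2003.05512 — 4 statements merged into one kernel-verified Lean document; each statement's English description precedes it below -/
import Mathlib

section
/- Let 𝔹 be a real Banach space, O ⊆ 𝔹 open, U a metric space, and F : U × O → 𝔹 continuous. Suppose there is γ : U → (0,∞) with ‖F(u,y)‖ ≤ γ(u)(1 + ‖y‖) for all u ∈ U, y ∈ O, and that for every y₀ ∈ O there exist r_{y₀} > 0 and γ_{y₀} : U → (0,∞) such that ‖F(u,y) − F(u,y')‖ ≤ γ_{y₀}(u)‖y − y'‖ whenever y, y' ∈ O satisfy ‖y − y₀‖ ≤ r_{y₀} and ‖y' − y₀‖ ≤ r_{y₀}, and all u ∈ U. Fix T > 0 and let u : [0,T] → U be admissible (the almost-everywhere pointwise limit of a sequence of simple functions) with t ↦ γ(u(t)) integrable on [0,T] and, for each y₀ ∈ O, t ↦ γ_{y₀}(u(t)) integrable on [0,T]. Then for every y₀ ∈ O there exists a largest T₀ ∈ (0,T] such that there is a unique continuous y : [0,T₀) → O satisfying y(t) = y₀ + ∫₀ᵗ F(u(s),y(s)) ds (Bochner integral) for all t ∈ [0,T₀). -/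
open MeasureTheory Filter Set
open scoped Topology

noncomputable section

/-- A simple function: measurable with finitely many values. -/
def IsSimpleFun {U : Type*} (f : ℝ → U) : Prop :=
  (Set.range f).Finite ∧ ∀ a : U, MeasurableSet (f ⁻¹' {a})

/-- An admissible control: a.e. pointwise limit on `[0,T]` of simple functions. -/
def Admissible {U : Type*} [MetricSpace U] (T : ℝ) (u : ℝ → U) : Prop :=
  ∃ un : ℕ → ℝ → U, (∀ n, IsSimpleFun (un n)) ∧
    ∀ᵐ t ∂(volume.restrict (Icc (0 : ℝ) T)), Tendsto (fun n => un n t) atTop (𝓝 (u t))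

/-- `y` is a solution of the controlled ODE `∂ₜ y = F(u(t), y(t))`, `y(0) = y₀`, on
`[0, T₀)`, in the integral (Bochner) sense, with values in `O`. -/
def IsSolOn {𝔹 : Type*} [NormedAddCommGroup 𝔹] [NormedSpace ℝ 𝔹] {U : Type*}
    (F : U → 𝔹 → 𝔹) (u : ℝ → U) (O : Set 𝔹) (y₀ : 𝔹) (T₀ : ℝ) (y : ℝ → 𝔹) : Prop :=
  ContinuousOn y (Ico (0 : ℝ) T₀) ∧ (∀ t ∈ Ico (0 : ℝ) T₀, y t ∈ O) ∧
    ∀ t ∈ Ico (0 : ℝ) T₀,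
      IntervalIntegrable (fun s => F (u s) (y s)) volume 0 t ∧
        y t = y₀ + ∫ s in (0 : ℝ)..t, F (u s) (y s)

lemma aux_meas {𝔹 : Type*} [NormedAddCommGroup 𝔹] [NormedSpace ℝ 𝔹]
    {U : Type*} [MetricSpace U]
    {O : Set 𝔹} {F : U → 𝔹 → 𝔹}
    (hF : ContinuousOn (fun p : U × 𝔹 => F p.1 p.2) (univ ×ˢ O))
    {T : ℝ} {u : ℝ → U} (hu : Admissible T u)
    {A : Set ℝ} (hA : MeasurableSet A) (hAT : A ⊆ Icc 0 T)
    {y : ℝ → 𝔹} (hy : ContinuousOn y A) (hyO : ∀ t ∈ A, y t ∈ O) :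
    AEStronglyMeasurable (fun s => F (u s) (y s)) (volume.restrict A) := by
  obtain ⟨un, hs, hlim⟩ := hu
  refine aestronglyMeasurable_of_tendsto_ae atTop (f := fun n s => F (un n s) (y s)) ?_ ?_
  · intro n
    obtain ⟨hfin, hm⟩ := hs n
    have : Countable (Set.range (un n)) := hfin.countable
    have hAU : A = ⋃ a : Set.range (un n), A ∩ (un n) ⁻¹' {a.1} := by
      ext t; simp
    rw [hAU, aestronglyMeasurable_iUnion_iff]
    rintro ⟨a, ha⟩
    have hc : AEStronglyMeasurable (fun s => F a (y s))
        (volume.restrict (A ∩ (un n) ⁻¹' {a})) := by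
      have h1 : ContinuousOn (fun s => F a (y s)) A := by
        have := hF.comp (f := fun s => (a, y s)) (s := A) (continuousOn_const.prodMk hy)
          (fun t ht => ⟨mem_univ _, hyO t ht⟩)
        exact this
      exact (h1.aestronglyMeasurable hA).mono_measure
        (Measure.restrict_mono inter_subset_left le_rfl)
    refine hc.congr ?_
    filter_upwards [ae_restrict_mem (hA.inter (hm a))] with s hs
    have : un n s = a := hs.2
    simp only [this]
  · have h2 := ae_restrict_of_ae_restrict_of_subset hAT hlim
    filter_upwards [h2, ae_restrict_mem hA] with s hs hsA
    have hcont := hF (u s, y s) ⟨mem_univ _, hyO s hsA⟩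
    have : Tendsto (fun n => (un n s, y s)) atTop (𝓝[univ ×ˢ O] (u s, y s)) := by
      refine tendsto_nhdsWithin_iff.2 ⟨hs.prodMk_nhds tendsto_const_nhds, ?_⟩
      exact Eventually.of_forall fun n => ⟨mem_univ _, hyO s hsA⟩
    exact hcont.tendsto.comp this

lemma aux_small {g : ℝ → ℝ} (hg : Integrable g) (a : ℝ) {ε : ℝ} (hε : 0 < ε) :
    ∀ᶠ t in 𝓝 a, |∫ s in a..t, g s| < ε := by
  have hc : Continuous fun t => |∫ s in a..t, g s| :=
    (intervalIntegral.continuous_primitive (fun _ _ => hg.intervalIntegrable) a).abs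
  have := hc.tendsto a
  simp only [intervalIntegral.integral_same, abs_zero] at this
  exact this.eventually (gt_mem_nhds hε)

lemma aux_unique {𝔹 : Type*} [NormedAddCommGroup 𝔹] [NormedSpace ℝ 𝔹]
    {U : Type*} {O : Set 𝔹} {F : U → 𝔹 → 𝔹}
    {r : 𝔹 → ℝ} {γloc : 𝔹 → U → ℝ}
    (hr : ∀ y₀ ∈ O, 0 < r y₀)
    (hγloc : ∀ y₀ ∈ O, ∀ u : U, 0 < γloc y₀ u)
    (hlip : ∀ y₀ ∈ O, ∀ u : U, ∀ y ∈ O, ∀ y' ∈ O,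
      ‖y - y₀‖ ≤ r y₀ → ‖y' - y₀‖ ≤ r y₀ → ‖F u y - F u y'‖ ≤ γloc y₀ u * ‖y - y'‖)
    {T : ℝ} {u : ℝ → U}
    (hγlocint : ∀ y₀ ∈ O, IntegrableOn (fun t => γloc y₀ (u t)) (Icc 0 T))
    {y₀ : 𝔹} {T₁ : ℝ} (hT₁ : T₁ ≤ T) {y z : ℝ → 𝔹}
    (hy : IsSolOn F u O y₀ T₁ y) (hz : IsSolOn F u O y₀ T₁ z) :
    EqOn y z (Ico 0 T₁) := by
  obtain ⟨hyc, hyO, hyi⟩ := hy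
  obtain ⟨hzc, hzO, hzi⟩ := hz
  intro b hb
  have hsub : Icc 0 b ⊆ Ico 0 T₁ := fun t ht => ⟨ht.1, ht.2.trans_lt hb.2⟩
  have hyb := hyc.mono hsub
  have hzb := hzc.mono hsub
  suffices h : Icc 0 b ⊆ {t | y t = z t} from h ⟨hb.1, le_rfl⟩
  refine IsClosed.Icc_subset_of_forall_exists_gt ?_ ?_ ?_
  · have : {t | y t = z t} ∩ Icc 0 b = Icc 0 b ∩ (fun t => y t - z t) ⁻¹' {0} := by
      ext t; simp [sub_eq_zero, and_comm]
    rw [this]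
    exact (hyb.sub hzb).preimage_isClosed_of_isClosed isClosed_Icc isClosed_singleton
  · have h0 : (0:ℝ) ∈ Ico 0 T₁ := hsub ⟨le_rfl, hb.1⟩
    have h1 := (hyi 0 h0).2
    have h2 := (hzi 0 h0).2
    simp only [intervalIntegral.integral_same] at h1 h2
    exact h1.trans h2.symm
  · rintro x ⟨hxe, hx⟩ w hw
    have hxe : y x = z x := hxe
    have hxI : x ∈ Ico 0 T₁ := hsub ⟨hx.1, hx.2.le⟩
    have haO := hyO x hxI
    set g : ℝ → ℝ := (Icc 0 T).indicator (fun t => γloc (y x) (u t)) with hgdef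
    have hg : Integrable g := (hγlocint _ haO).integrable_indicator measurableSet_Icc
    have hIcc : Icc 0 b ∈ 𝓝[≥] x :=
      mem_of_superset (Icc_mem_nhdsGE hx.2) (Icc_subset_Icc_left hx.1)
    have ey : ∀ᶠ t in 𝓝[≥] x, ‖y t - y x‖ ≤ r (y x) := by
      have h1 : ContinuousWithinAt y (Ici x) x :=
        (hyb x ⟨hx.1, hx.2.le⟩).mono_of_mem_nhdsWithin hIcc
      have := h1.tendsto.eventually (Metric.closedBall_mem_nhds (y x) (hr _ haO))
      simpa only [Metric.mem_closedBall, dist_eq_norm] using this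
    have ez : ∀ᶠ t in 𝓝[≥] x, ‖z t - y x‖ ≤ r (y x) := by
      have h1 : ContinuousWithinAt z (Ici x) x :=
        (hzb x ⟨hx.1, hx.2.le⟩).mono_of_mem_nhdsWithin hIcc
      have := h1.tendsto.eventually (Metric.closedBall_mem_nhds (z x) (hr _ (hzO x hxI)))
      rw [hxe]
      simpa only [Metric.mem_closedBall, dist_eq_norm] using this
    have es : ∀ᶠ t in 𝓝[≥] x, |∫ s in x..t, g s| < 1/2 :=
      (aux_small hg x (by norm_num)).filter_mono nhdsWithin_le_nhds
    have ew : Icc x w ∈ 𝓝[≥] x := Icc_mem_nhdsGE hw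
    have eall := (ey.and (ez.and (es.and ((eventually_mem_set.2 hIcc).and ew))))
    obtain ⟨d, hd, hall⟩ := (mem_nhdsGE_iff_exists_Icc_subset).1 eall
    have hd : x < d := hd
    refine ⟨d, ?_, hd, ((hall ⟨hd.le, le_rfl⟩).2.2.2.2).2⟩
    have hdb : Icc x d ⊆ Icc 0 b := fun t ht => (hall ht).2.2.2.1
    obtain ⟨c, hc, hmax⟩ := isCompact_Icc.exists_isMaxOn (nonempty_Icc.2 hd.le)
      (((hyb.sub hzb).mono hdb).norm)
    have hmax : ∀ t ∈ Icc x d, ‖y t - z t‖ ≤ ‖y c - z c‖ := fun t ht => hmax ht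
    have hcI := hsub (hdb hc)
    have hdiff : y c - z c = ∫ s in x..c, (F (u s) (y s) - F (u s) (z s)) := by
      have iy := ((hyi x hxI).1.symm.trans (hyi c hcI).1)
      have iz := ((hzi x hxI).1.symm.trans (hzi c hcI).1)
      rw [intervalIntegral.integral_sub iy iz,
        ← intervalIntegral.integral_interval_sub_left (hyi c hcI).1 (hyi x hxI).1,
        ← intervalIntegral.integral_interval_sub_left (hzi c hcI).1 (hzi x hxI).1]
      have e1 := (hyi c hcI).2
      have e2 := (hyi x hxI).2
      have e3 := (hzi c hcI).2
      have e4 := (hzi x hxI).2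
      rw [e2, e4] at hxe
      have hxe := add_left_cancel hxe
      rw [e1, e3, hxe]
      abel
    have hle : ‖y c - z c‖ ≤ ∫ s in x..c, g s * ‖y c - z c‖ := by
      conv_lhs => rw [hdiff]
      refine intervalIntegral.norm_integral_le_of_norm_le hc.1 ?_
        (hg.mul_const _).intervalIntegrable
      refine Eventually.of_forall fun s hs => ?_
      have hsd : s ∈ Icc x d := ⟨hs.1.le, hs.2.trans hc.2⟩
      have hsI := hsub (hdb hsd)
      have hsT : s ∈ Icc 0 T := ⟨hsI.1, hsI.2.le.trans hT₁⟩
      have hgs : g s = γloc (y x) (u s) := by rw [hgdef, indicator_of_mem hsT]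
      rw [hgs]
      refine (hlip _ haO (u s) _ (hyO s hsI) _ (hzO s hsI) (hall hsd).1 (hall hsd).2.1).trans ?_
      exact mul_le_mul_of_nonneg_left (hmax s hsd) (hγloc _ haO _).le
    rw [intervalIntegral.integral_mul_const] at hle
    have h12 := (abs_lt.1 (hall hc).2.2.1).2
    have hz0 : ‖y c - z c‖ ≤ 0 := by
      nlinarith [norm_nonneg (y c - z c)]
    have := (hmax d ⟨hd.le, le_rfl⟩).trans hz0
    exact sub_eq_zero.1 (norm_le_zero_iff.1 this)

lemma aux_exists {𝔹 : Type*} [NormedAddCommGroup 𝔹] [NormedSpace ℝ 𝔹] [CompleteSpace 𝔹]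
    {U : Type*} [MetricSpace U]
    {O : Set 𝔹} (hO : IsOpen O)
    {F : U → 𝔹 → 𝔹}
    (hF : ContinuousOn (fun p : U × 𝔹 => F p.1 p.2) (univ ×ˢ O))
    {γ : U → ℝ} (hγ : ∀ u : U, 0 < γ u)
    (hgrowth : ∀ u : U, ∀ y ∈ O, ‖F u y‖ ≤ γ u * (1 + ‖y‖))
    {r : 𝔹 → ℝ} {γloc : 𝔹 → U → ℝ}
    (hr : ∀ y₀ ∈ O, 0 < r y₀)
    (hγloc : ∀ y₀ ∈ O, ∀ u : U, 0 < γloc y₀ u)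
    (hlip : ∀ y₀ ∈ O, ∀ u : U, ∀ y ∈ O, ∀ y' ∈ O,
      ‖y - y₀‖ ≤ r y₀ → ‖y' - y₀‖ ≤ r y₀ → ‖F u y - F u y'‖ ≤ γloc y₀ u * ‖y - y'‖)
    {T : ℝ} (hT : 0 < T)
    {u : ℝ → U} (hu : Admissible T u)
    (hγint : IntegrableOn (fun t => γ (u t)) (Icc 0 T))
    (hγlocint : ∀ y₀ ∈ O, IntegrableOn (fun t => γloc y₀ (u t)) (Icc 0 T))
    {y₀ : 𝔹} (hy₀ : y₀ ∈ O) :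
    ∃ δ ∈ Ioc (0 : ℝ) T, ∃ y : ℝ → 𝔹, IsSolOn F u O y₀ δ y := by
  obtain ⟨ρ', hρ', hρO'⟩ := Metric.nhds_basis_closedBall.mem_iff.1 (hO.mem_nhds hy₀)
  set ρ := min ρ' (r y₀) with hρdef
  have hρ : 0 < ρ := lt_min hρ' (hr _ hy₀)
  have hρO : Metric.closedBall y₀ ρ ⊆ O :=
    (Metric.closedBall_subset_closedBall (min_le_left _ _)).trans hρO'
  have hρr : ρ ≤ r y₀ := min_le_right _ _
  set C : ℝ := 1 + ‖y₀‖ + ρ with hC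
  have hCpos : 0 < C := by positivity
  have hg1 := (hγint.integrable_indicator measurableSet_Icc)
  have hg2 := ((hγlocint _ hy₀).integrable_indicator measurableSet_Icc)
  have e1 := (aux_small hg1 0 (div_pos hρ hCpos)).filter_mono (nhdsWithin_le_nhds (s := Ioi 0))
  have e2 := (aux_small hg2 0 (one_half_pos (α := ℝ))).filter_mono
    (nhdsWithin_le_nhds (s := Ioi 0))
  have e3 : ∀ᶠ t in 𝓝[>] (0:ℝ), t ∈ Ioc 0 T := Ioc_mem_nhdsGT hT
  obtain ⟨δ, h1, h2, hδ⟩ := (e1.and (e2.and e3)).exists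
  refine ⟨δ, hδ, ?_⟩
  have hsubT : Icc 0 δ ⊆ Icc 0 T := Icc_subset_Icc_right hδ.2
  have key : ∀ g : ℝ → ℝ, ∫ s in (0:ℝ)..δ, (Icc 0 T).indicator g s = ∫ s in Icc 0 δ, g s := by
    intro g
    rw [intervalIntegral.integral_of_le hδ.1.le, ← integral_Icc_eq_integral_Ioc]
    refine setIntegral_congr_fun measurableSet_Icc fun s hs => ?_
    exact indicator_of_mem (hsubT hs) g
  rw [key] at h1 h2
  have h1 := (abs_lt.1 h1).2
  have h2 := (abs_lt.1 h2).2
  have hγδ := hγint.mono_set hsubT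
  have hγlδ := (hγlocint _ hy₀).mono_set hsubT
  -- the space
  let X : Set (BoundedContinuousFunction ℝ 𝔹) := {f | ∀ t, f t ∈ Metric.closedBall y₀ ρ}
  have hXc : IsClosed X := by
    have : X = ⋂ t, (fun f : BoundedContinuousFunction ℝ 𝔹 => f t) ⁻¹' Metric.closedBall y₀ ρ := by
      ext f; simp [X]
    rw [this]
    exact isClosed_iInter fun t => Metric.isClosed_closedBall.preimage
      (BoundedContinuousFunction.lipschitz_eval_const t).continuous
  let G : BoundedContinuousFunction ℝ 𝔹 → ℝ → 𝔹 := fun f =>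
    (Icc 0 δ).indicator (fun s => F (u s) (f s))
  have hbound : ∀ f ∈ X, ∀ s, ‖F (u s) (f s)‖ ≤ γ (u s) * C := by
    intro f hf s
    refine (hgrowth _ _ (hρO (hf s))).trans ?_
    refine mul_le_mul_of_nonneg_left ?_ (hγ _).le
    have := mem_closedBall_iff_norm.1 (hf s)
    have h3 := norm_le_norm_add_norm_sub' (f s) y₀
    rw [hC]; linarith
  have hGon : ∀ f ∈ X, IntegrableOn (fun s => F (u s) (f s)) (Icc 0 δ) := by
    intro f hf
    refine Integrable.mono' (hγδ.mul_const C) ?_ (Eventually.of_forall (hbound f hf))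
    exact aux_meas hF hu measurableSet_Icc hsubT f.continuous.continuousOn
      (fun t _ => hρO (hf t))
  have hGint : ∀ f ∈ X, Integrable (G f) := fun f hf =>
    (hGon f hf).integrable_indicator measurableSet_Icc
  have hest : ∀ H : ℝ → 𝔹, Integrable H → ∀ t, ‖∫ s in (0:ℝ)..t, H s‖ ≤ ∫ s, ‖H s‖ := by
    intro H hH t
    refine intervalIntegral.norm_integral_le_integral_norm_uIoc.trans ?_
    exact setIntegral_le_integral hH.norm (Eventually.of_forall fun s => norm_nonneg _)
  have hGest : ∀ f ∈ X, ∀ t, ‖∫ s in (0:ℝ)..t, G f s‖ ≤ ρ := by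
    intro f hf t
    refine (hest _ (hGint f hf) t).trans ?_
    have : ∫ s, ‖G f s‖ ≤ ∫ s in Icc 0 δ, γ (u s) * C := by
      rw [← integral_indicator measurableSet_Icc]
      refine integral_mono (hGint f hf).norm
        (IntegrableOn.integrable_indicator (hγδ.mul_const C) measurableSet_Icc) fun s => ?_
      simp only [G, norm_indicator_eq_indicator_norm]
      exact indicator_le_indicator (hbound f hf s)
    refine this.trans ?_
    rw [integral_mul_const]
    rw [lt_div_iff₀ hCpos] at h1
    exact h1.le
  let Φ : X → X := fun f => ⟨BoundedContinuousFunction.ofNormedAddCommGroup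
      (fun t => y₀ + ∫ s in (0:ℝ)..t, G f.1 s)
      (continuous_const.add (intervalIntegral.continuous_primitive
        (fun _ _ => (hGint f.1 f.2).intervalIntegrable) 0)) (‖y₀‖ + ρ)
      (fun t => (norm_add_le _ _).trans (by gcongr; exact hGest f.1 f.2 t)), by
      intro t
      rw [mem_closedBall_iff_norm]
      simpa using hGest f.1 f.2 t⟩
  have hΦ : ∀ f : X, ∀ t, (Φ f).1 t = y₀ + ∫ s in (0:ℝ)..t, G f.1 s := fun f t => rfl
  have hcontr : ContractingWith (1/2) Φ := by
    refine ⟨by norm_num, LipschitzWith.of_dist_le_mul fun f f' => ?_⟩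
    rw [Subtype.dist_eq, Subtype.dist_eq]
    refine (BoundedContinuousFunction.dist_le (by positivity)).2 fun t => ?_
    rw [hΦ, hΦ, dist_add_left, dist_eq_norm, ← intervalIntegral.integral_sub
      (hGint f.1 f.2).intervalIntegrable (hGint f'.1 f'.2).intervalIntegrable]
    have hi := (hGint f.1 f.2).sub (hGint f'.1 f'.2)
    refine (hest _ hi t).trans ?_
    have : ∫ s, ‖G f.1 s - G f'.1 s‖ ≤
        ∫ s in Icc 0 δ, γloc y₀ (u s) * dist f.1 f'.1 := by
      rw [← integral_indicator measurableSet_Icc]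
      refine integral_mono hi.norm
        (IntegrableOn.integrable_indicator (hγlδ.mul_const _) measurableSet_Icc) fun s => ?_
      simp only [G]
      by_cases hs : s ∈ Icc 0 δ
      · simp only [indicator_of_mem hs]
        refine (hlip y₀ hy₀ (u s) _ (hρO (f.2 s)) _ (hρO (f'.2 s))
          ((mem_closedBall_iff_norm.1 (f.2 s)).trans hρr)
          ((mem_closedBall_iff_norm.1 (f'.2 s)).trans hρr)).trans ?_
        refine mul_le_mul_of_nonneg_left ?_ (hγloc _ hy₀ _).le
        rw [← dist_eq_norm]
        exact BoundedContinuousFunction.dist_coe_le_dist s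
      · simp [indicator_of_notMem hs]
    refine this.trans ?_
    rw [integral_mul_const]
    refine mul_le_mul_of_nonneg_right ?_ dist_nonneg
    simpa using h2.le
  have : CompleteSpace X := hXc.completeSpace_coe
  have : Nonempty X := ⟨⟨BoundedContinuousFunction.const ℝ y₀, fun t => by
    simpa using hρ.le⟩⟩
  have hfix := hcontr.fixedPoint_isFixedPt
  set f := ContractingWith.fixedPoint Φ hcontr
  refine ⟨f.1, f.1.continuous.continuousOn, fun t _ => hρO (f.2 t), fun t ht => ⟨?_, ?_⟩⟩
  · rw [intervalIntegrable_iff_integrableOn_Icc_of_le ht.1]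
    exact (hGon f.1 f.2).mono_set (Icc_subset_Icc_right ht.2.le)
  · have h3 := hΦ f t
    rw [hfix] at h3
    rw [h3]
    congr 1
    refine intervalIntegral.integral_congr fun s hs => ?_
    rw [uIcc_of_le ht.1] at hs
    exact indicator_of_mem (show s ∈ Icc 0 δ from ⟨hs.1, hs.2.trans ht.2.le⟩) _

lemma aux_mono {𝔹 : Type*} [NormedAddCommGroup 𝔹] [NormedSpace ℝ 𝔹] {U : Type*}
    {F : U → 𝔹 → 𝔹} {u : ℝ → U} {O : Set 𝔹} {y₀ : 𝔹} {T₀ T₁ : ℝ} (h : T₁ ≤ T₀) {y : ℝ → 𝔹}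
    (hy : IsSolOn F u O y₀ T₀ y) : IsSolOn F u O y₀ T₁ y := by
  have hs : Ico 0 T₁ ⊆ Ico 0 T₀ := Ico_subset_Ico_right h
  exact ⟨hy.1.mono hs, fun t ht => hy.2.1 t (hs ht), fun t ht => hy.2.2 t (hs ht)⟩

/-- **Theorem 7.1 (controlled ODE: maximal existence and uniqueness).**
Under a linear growth bound and a local Lipschitz condition with `u`-dependent
integrable constants, for every initial point `y₀ ∈ O` there is a largest
`T₀ ∈ (0,T]` on which the controlled ODE has a unique solution. -/
theorem controlled_ode_maximal_existence_uniqueness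
    {𝔹 : Type*} [NormedAddCommGroup 𝔹] [NormedSpace ℝ 𝔹] [CompleteSpace 𝔹]
    {U : Type*} [MetricSpace U]
    (O : Set 𝔹) (hO : IsOpen O)
    (F : U → 𝔹 → 𝔹)
    (hF : ContinuousOn (fun p : U × 𝔹 => F p.1 p.2) (univ ×ˢ O))
    (γ : U → ℝ) (hγ : ∀ u : U, 0 < γ u)
    (hgrowth : ∀ u : U, ∀ y ∈ O, ‖F u y‖ ≤ γ u * (1 + ‖y‖))
    (r : 𝔹 → ℝ) (γloc : 𝔹 → U → ℝ)
    (hr : ∀ y₀ ∈ O, 0 < r y₀)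
    (hγloc : ∀ y₀ ∈ O, ∀ u : U, 0 < γloc y₀ u)
    (hlip : ∀ y₀ ∈ O, ∀ u : U, ∀ y ∈ O, ∀ y' ∈ O,
      ‖y - y₀‖ ≤ r y₀ → ‖y' - y₀‖ ≤ r y₀ → ‖F u y - F u y'‖ ≤ γloc y₀ u * ‖y - y'‖)
    (T : ℝ) (hT : 0 < T)
    (u : ℝ → U) (hu : Admissible T u)
    (hγint : IntegrableOn (fun t => γ (u t)) (Icc 0 T))
    (hγlocint : ∀ y₀ ∈ O, IntegrableOn (fun t => γloc y₀ (u t)) (Icc 0 T))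
    (y₀ : 𝔹) (hy₀ : y₀ ∈ O) :
    ∃ T₀ ∈ Ioc (0 : ℝ) T,
      (∃ y : ℝ → 𝔹, IsSolOn F u O y₀ T₀ y ∧
        ∀ z : ℝ → 𝔹, IsSolOn F u O y₀ T₀ z → EqOn z y (Ico 0 T₀)) ∧
      ∀ T₁ ∈ Ioc (0 : ℝ) T,
        (∃ y : ℝ → 𝔹, IsSolOn F u O y₀ T₁ y ∧
          ∀ z : ℝ → 𝔹, IsSolOn F u O y₀ T₁ z → EqOn z y (Ico 0 T₁)) → T₁ ≤ T₀ := by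
  have huniq : ∀ T₁ ≤ T, ∀ y z : ℝ → 𝔹, IsSolOn F u O y₀ T₁ y → IsSolOn F u O y₀ T₁ z →
      EqOn y z (Ico 0 T₁) := fun T₁ h y z hy hz =>
    aux_unique hr hγloc hlip hγlocint h hy hz
  obtain ⟨δ, hδ, yδ, hyδ⟩ := aux_exists hO hF hγ hgrowth hr hγloc hlip hT hu hγint hγlocint hy₀
  set S : Set ℝ := {T₁ | T₁ ∈ Ioc 0 T ∧ ∃ y : ℝ → 𝔹, IsSolOn F u O y₀ T₁ y} with hS
  have hSb : BddAbove S := ⟨T, fun t ht => ht.1.2⟩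
  have hδS : δ ∈ S := ⟨hδ, yδ, hyδ⟩
  have hSne : S.Nonempty := ⟨δ, hδS⟩
  have hT₀ : sSup S ∈ Ioc 0 T :=
    ⟨hδ.1.trans_le (le_csSup hSb hδS), csSup_le hSne fun t ht => ht.1.2⟩
  refine ⟨sSup S, hT₀, ?_, fun T₁ h1 ⟨y, hy, _⟩ => le_csSup hSb ⟨h1, y, hy⟩⟩
  suffices h : ∃ y : ℝ → 𝔹, IsSolOn F u O y₀ (sSup S) y by
    obtain ⟨y, hy⟩ := h
    exact ⟨y, hy, fun z hz => huniq _ hT₀.2 z y hz hy⟩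
  have hex : ∀ t : ℝ, ∃ v : 𝔹, ∀ T₁ ∈ S, t ∈ Ico 0 T₁ → ∀ z : ℝ → 𝔹,
      IsSolOn F u O y₀ T₁ z → z t = v := by
    intro t
    by_cases h : ∃ T₁ ∈ S, t ∈ Ico 0 T₁
    · obtain ⟨T₁, hT₁, ht⟩ := h
      obtain ⟨z₁, hz₁⟩ := hT₁.2
      refine ⟨z₁ t, fun T₂ hT₂ ht₂ z hz => ?_⟩
      exact huniq (min T₁ T₂) ((min_le_left _ _).trans hT₁.1.2) z z₁
        (aux_mono (min_le_right _ _) hz) (aux_mono (min_le_left _ _) hz₁)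
        ⟨ht.1, lt_min ht.2 ht₂.2⟩
    · exact ⟨0, fun T₁ h1 h2 => absurd ⟨T₁, h1, h2⟩ h⟩
  choose y hy using hex
  have hloc : ∀ t ∈ Ico 0 (sSup S), ∃ T₁ ∈ S, t ∈ Ico 0 T₁ ∧ ∃ z : ℝ → 𝔹,
      IsSolOn F u O y₀ T₁ z ∧ EqOn z y (Ico 0 T₁) := by
    intro t ht
    obtain ⟨T₁, hT₁, h⟩ := exists_lt_of_lt_csSup hSne ht.2
    obtain ⟨z, hz⟩ := hT₁.2
    exact ⟨T₁, hT₁, ⟨ht.1, h⟩, z, hz, fun s hs => hy s T₁ hT₁ hs z hz⟩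
  refine ⟨y, ?_, ?_, ?_⟩
  · intro t ht
    obtain ⟨T₁, hT₁, htT, z, hz, he⟩ := hloc t ht
    have h1 : ContinuousWithinAt y (Ico 0 T₁) t := (hz.1 t htT).congr
      (fun s hs => (he hs).symm) (he htT).symm
    refine h1.mono_of_mem_nhdsWithin ?_
    have : Iio T₁ ∈ 𝓝[Ico 0 (sSup S)] t := mem_nhdsWithin_of_mem_nhds (Iio_mem_nhds htT.2)
    filter_upwards [this, self_mem_nhdsWithin] with s hs1 hs2
    exact ⟨hs2.1, hs1⟩
  · intro t ht
    obtain ⟨T₁, hT₁, htT, z, hz, he⟩ := hloc t ht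
    rw [← he htT]
    exact hz.2.1 t htT
  · intro t ht
    obtain ⟨T₁, hT₁, htT, z, hz, he⟩ := hloc t ht
    obtain ⟨hi, heq⟩ := hz.2.2 t htT
    have hst : ∀ s ∈ uIcc 0 t, z s = y s := by
      intro s hs
      rw [uIcc_of_le ht.1] at hs
      exact he ⟨hs.1, hs.2.trans_lt htT.2⟩
    refine ⟨hi.congr fun s hs => ?_, ?_⟩
    · simp only [hst s (uIoc_subset_uIcc hs)]
    · rw [← he htT, heq]
      congr 1
      exact intervalIntegral.integral_congr fun s hs => by simp only [hst s hs]

end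
end

section
/- Let 𝔹 be a real Banach space, O ⊆ 𝔹 open, U a metric space, and F : U × O → 𝔹 continuous with ‖F(u,y)‖ ≤ γ(u)(1 + ‖y‖) for all u ∈ U, y ∈ O, where γ : U → (0,∞); assume the local Lipschitz condition: for every y₀ ∈ O there exist r_{y₀} > 0 and γ_{y₀} : U → (0,∞) with ‖F(u,y) − F(u,y')‖ ≤ γ_{y₀}(u)‖y − y'‖ for y,y' in the r_{y₀}-ball around y₀ in O. Let u : [0,T] → U be admissible with t ↦ γ(u(t)) and each t ↦ γ_{y₀}(u(t)) integrable, let y₀ ∈ O, and let y : [0,T₀) → O be a continuous solution of y(t) = y₀ + ∫₀ᵗ F(u(s),y(s)) ds on a maximal interval [0,T₀) with T₀ ≤ T. Then: (1) sup_{t ∈ [0,T₀)} ‖y(t)‖ ≤ (‖y₀‖ + ∫₀ᵀ γ(u(s)) ds) · exp(∫₀ᵀ γ(u(s)) ds); (2) y(t) converges in 𝔹 as t → T₀; and (3) if T₀ < T then lim_{t→T₀} y(t) ∉ O. -/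
open MeasureTheory Filter Set
open scoped Topology

noncomputable section

lemma gron_aux (b a : ℝ) (ha : 0 ≤ a) (g φ : ℝ → ℝ) (hg : ∀ t, 0 ≤ g t)
    (hφ : ContinuousOn φ (Icc 0 b)) (hφ0 : ∀ t, 0 ≤ φ t) (hb : 0 ≤ b)
    (hgi : IntervalIntegrable g volume 0 b)
    (h : ∀ t ∈ Icc 0 b, φ t ≤ a + ∫ s in (0:ℝ)..t, g s * φ s) :
    φ b ≤ a * Real.exp (∫ s in (0:ℝ)..b, g s) := by
  have hgφ : IntervalIntegrable (fun s => g s * φ s) volume 0 b :=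
    hgi.mul_continuousOn (by rwa [uIcc_of_le hb])
  have sub : ∀ f : ℝ → ℝ, IntervalIntegrable f volume 0 b → ∀ x ∈ Icc 0 b, ∀ t ∈ Icc 0 b,
      IntervalIntegrable f volume x t := by
    intro f hf x hx t ht
    apply hf.mono_set
    rw [uIcc_of_le hb]
    exact uIcc_subset_Icc hx ht
  have h0 : (0:ℝ) ∈ Icc 0 b := ⟨le_rfl, hb⟩
  set V : ℝ → ℝ := fun t => a + ∫ s in (0:ℝ)..t, g s * φ s with hVdef
  set G : ℝ → ℝ := fun t => ∫ s in (0:ℝ)..t, g s with hGdef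
  have hGc : ContinuousOn G (Icc 0 b) := by
    have := intervalIntegral.continuousOn_primitive_interval' hgi (left_mem_uIcc)
    rwa [uIcc_of_le hb] at this
  have hVc : ContinuousOn V (Icc 0 b) := by
    have := intervalIntegral.continuousOn_primitive_interval' hgφ (left_mem_uIcc)
    rw [uIcc_of_le hb] at this
    exact continuousOn_const.add this
  have hVm : ∀ x ∈ Icc 0 b, ∀ t ∈ Icc 0 b, x ≤ t → V x ≤ V t := by
    intro x hx t ht hxt
    have e : V t = V x + ∫ s in x..t, g s * φ s := by
      simp only [hVdef]
      rw [← intervalIntegral.integral_add_adjacent_intervals (sub _ hgφ 0 h0 x hx)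
        (sub _ hgφ x hx t ht)]
      ring
    have : 0 ≤ ∫ s in x..t, g s * φ s :=
      intervalIntegral.integral_nonneg hxt (fun s _ => mul_nonneg (hg s) (hφ0 s))
    linarith
  have hstep : ∀ x ∈ Icc 0 b, ∀ t ∈ Icc 0 b, x ≤ t → V t - V x ≤ (G t - G x) * V t := by
    intro x hx t ht hxt
    have e : V t = V x + ∫ s in x..t, g s * φ s := by
      simp only [hVdef]
      rw [← intervalIntegral.integral_add_adjacent_intervals (sub _ hgφ 0 h0 x hx)
        (sub _ hgφ x hx t ht)]
      ring
    have e2 : G t = G x + ∫ s in x..t, g s := by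
      simp only [hGdef]
      rw [← intervalIntegral.integral_add_adjacent_intervals (sub _ hgi 0 h0 x hx)
        (sub _ hgi x hx t ht)]
    have : ∫ s in x..t, g s * φ s ≤ ∫ s in x..t, g s * V t := by
      apply intervalIntegral.integral_mono_on hxt (sub _ hgφ x hx t ht)
        ((sub _ hgi x hx t ht).mul_const _)
      intro s hs
      have hs' : s ∈ Icc 0 b := ⟨hx.1.trans hs.1, hs.2.trans ht.2⟩
      exact mul_le_mul_of_nonneg_left ((h s hs').trans (hVm s hs' t ht hs.2)) (hg s)
    rw [intervalIntegral.integral_mul_const] at this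
    have e3 : ∫ s in x..t, g s = G t - G x := by linarith
    rw [e3] at this
    linarith
  have hGm : ∀ x ∈ Icc 0 b, ∀ t ∈ Icc 0 b, x ≤ t → G x ≤ G t := by
    intro x hx t ht hxt
    have e2 : G t = G x + ∫ s in x..t, g s := by
      simp only [hGdef]
      rw [← intervalIntegral.integral_add_adjacent_intervals (sub _ hgi 0 h0 x hx)
        (sub _ hgi x hx t ht)]
    have : 0 ≤ ∫ s in x..t, g s := intervalIntegral.integral_nonneg hxt (fun s _ => hg s)
    linarith
  have hV0 : V 0 = a := by simp [hVdef]
  have hG0 : G 0 = 0 := by simp [hGdef]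
  have key : ∀ ε > 0, V b ≤ a * Real.exp ((1 + ε) * G b) := by
    intro ε hε
    have hcl : IsClosed ({t | V t ≤ a * Real.exp ((1 + ε) * G t)} ∩ Icc 0 b) := by
      have : IsClosed {t ∈ Icc 0 b | V t ≤ a * Real.exp ((1 + ε) * G t)} := by
        apply isClosed_Icc.isClosed_le hVc
        exact continuousOn_const.mul (continuousOn_const.mul hGc).rexp
      convert this using 1
      ext t; simp [and_comm]
    refine hcl.Icc_subset_of_forall_exists_gt (a := 0) (b := b) ?_ ?_ (right_mem_Icc.2 hb)
    · simp [hV0, hG0]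
    rintro x ⟨hxs, hx⟩ z hz
    have hx' : x ∈ Icc 0 b := Ico_subset_Icc_self hx
    have hc : ContinuousWithinAt G (Ioi x) x :=
      (hGc x hx').mono_of_mem_nhdsWithin
        (mem_of_superset (Ioc_mem_nhdsGT hx.2) fun t ht => ⟨hx.1.trans ht.1.le, ht.2⟩)
    have hev : ∀ᶠ t in 𝓝[>] x, G t < G x + ε / (1 + ε) :=
      hc.tendsto.eventually_lt_const (by have : 0 < ε / (1 + ε) := by positivity
                                         linarith)
    obtain ⟨t, ht1, ht2⟩ := (hev.and (Ioc_mem_nhdsGT (lt_min hz hx.2))).exists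
    have ht' : t ∈ Icc 0 b := ⟨hx.1.trans ht2.1.le, ht2.2.trans (min_le_right _ _)⟩
    refine ⟨t, ?_, ht2.1, ht2.2.trans (min_le_left _ _)⟩
    have hs := hstep x hx' t ht' ht2.1.le
    have hd0 := hGm x hx' t ht' ht2.1.le
    have hVt : 0 ≤ V t := by
      have := hVm 0 h0 t ht' ht'.1
      linarith
    obtain ⟨d, hd⟩ : ∃ d, d = G t - G x := ⟨_, rfl⟩
    have hd1 : d * (1 + ε) ≤ ε := by
      have : d ≤ ε / (1 + ε) := by linarith
      rwa [le_div_iff₀ (by positivity)] at this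
    have hdn : 0 ≤ d := by linarith
    have hd1' : 0 ≤ 1 - d := by nlinarith
    have hexp : 1 ≤ (1 - d) * Real.exp ((1 + ε) * d) := by
      have h1 := Real.add_one_le_exp ((1 + ε) * d)
      have h2 : (1 - d) * ((1 + ε) * d + 1) ≤ (1 - d) * Real.exp ((1 + ε) * d) :=
        mul_le_mul_of_nonneg_left h1 hd1'
      nlinarith
    have hxs' : V x ≤ a * Real.exp ((1 + ε) * G x) := hxs
    have e : (1 + ε) * G t = (1 + ε) * G x + (1 + ε) * d := by rw [hd]; ring
    change V t ≤ a * Real.exp ((1 + ε) * G t)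
    rw [e, Real.exp_add]
    rw [← hd] at hs
    calc V t ≤ V t * ((1 - d) * Real.exp ((1 + ε) * d)) := le_mul_of_one_le_right hVt hexp
      _ = (V t - d * V t) * Real.exp ((1 + ε) * d) := by ring
      _ ≤ (a * Real.exp ((1 + ε) * G x)) * Real.exp ((1 + ε) * d) := by
          gcongr; linarith
      _ = _ := by ring
  refine (h b (right_mem_Icc.2 hb)).trans ?_
  have ht : Tendsto (fun ε : ℝ => a * Real.exp ((1 + ε) * G b)) (𝓝[>] 0)
      (𝓝 (a * Real.exp ((1 + 0) * G b))) := by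
    apply Tendsto.mono_left _ nhdsWithin_le_nhds
    apply Continuous.tendsto (by fun_prop)
  rw [add_zero, one_mul] at ht
  exact ge_of_tendsto ht (by filter_upwards [self_mem_nhdsWithin] with ε hε using key ε hε)

lemma adm_meas {U : Type*} [MetricSpace U] {T : ℝ} {u : ℝ → U} (hu : Admissible T u) :
    AEStronglyMeasurable u (volume.restrict (Icc (0 : ℝ) T)) := by
  obtain ⟨un, h1, h2⟩ := hu
  refine aestronglyMeasurable_of_tendsto_ae atTop (f := un) (fun n => ?_) h2
  exact (SimpleFunc.stronglyMeasurable ⟨un n, (h1 n).2, (h1 n).1⟩).aestronglyMeasurable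

lemma comp_meas {𝔹 : Type*} [NormedAddCommGroup 𝔹] {U : Type*} [MetricSpace U]
    {O : Set 𝔹} {F : U → 𝔹 → 𝔹}
    (hF : ContinuousOn (fun p : U × 𝔹 => F p.1 p.2) (univ ×ˢ O))
    {T : ℝ} {u : ℝ → U} (hu : Admissible T u) {w : ℝ → 𝔹} (hw : Continuous w)
    (hwO : ∀ t, w t ∈ O) :
    AEStronglyMeasurable (fun s => F (u s) (w s)) (volume.restrict (Icc (0 : ℝ) T)) := by
  let w' : ℝ → O := fun t => ⟨w t, hwO t⟩
  have hw' : Continuous w' := hw.subtype_mk _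
  have hF' : Continuous (fun p : U × O => F p.1 p.2) :=
    hF.comp_continuous (f := fun p : U × O => ((p.1, (p.2 : 𝔹)) : U × 𝔹)) (by fun_prop)
      (fun p => ⟨mem_univ _, p.2.2⟩)
  exact hF'.comp_aestronglyMeasurable ((adm_meas hu).prodMk hw'.aestronglyMeasurable)

lemma hii_aux {E : Type*} [NormedAddCommGroup E] {T₀ T : ℝ} (h0 : 0 ≤ T₀) (f : ℝ → E)
    (hf : IntegrableOn f (Icc 0 T)) (a : ℝ) (ha : a ∈ Icc T₀ T) (b : ℝ) (hb : b ∈ Icc T₀ T) :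
    IntervalIntegrable f volume a b := by
  apply IntegrableOn.intervalIntegrable
  exact hf.mono_set ((uIcc_subset_Icc ha hb).trans (Icc_subset_Icc_left h0))

lemma local_exist {𝔹 : Type*} [NormedAddCommGroup 𝔹] [NormedSpace ℝ 𝔹] [CompleteSpace 𝔹]
    {U : Type*} [MetricSpace U]
    (O : Set 𝔹) (hO : IsOpen O)
    (F : U → 𝔹 → 𝔹)
    (hF : ContinuousOn (fun p : U × 𝔹 => F p.1 p.2) (univ ×ˢ O))
    (γ : U → ℝ) (hγ : ∀ u : U, 0 < γ u)
    (hgrowth : ∀ u : U, ∀ y ∈ O, ‖F u y‖ ≤ γ u * (1 + ‖y‖))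
    (L : 𝔹) (hL : L ∈ O) (r : ℝ) (γl : U → ℝ) (hr : 0 < r) (hγl : ∀ u, 0 < γl u)
    (hlip : ∀ u : U, ∀ y ∈ O, ∀ y' ∈ O,
      ‖y - L‖ ≤ r → ‖y' - L‖ ≤ r → ‖F u y - F u y'‖ ≤ γl u * ‖y - y'‖)
    (T : ℝ) (u : ℝ → U) (hu : Admissible T u)
    (hγint : IntegrableOn (fun t => γ (u t)) (Icc 0 T))
    (hγlint : IntegrableOn (fun t => γl (u t)) (Icc 0 T))
    (T₀ : ℝ) (h0 : 0 ≤ T₀) (hT₀ : T₀ < T) :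
    ∃ T₁, T₀ < T₁ ∧ T₁ ≤ T ∧ ∃ w : ℝ → 𝔹, Continuous w ∧ (∀ t, w t ∈ O) ∧
      IntervalIntegrable (fun s => F (u s) (w s)) volume T₀ T₁ ∧
      ∀ t ∈ Icc T₀ T₁, w t = L + ∫ s in T₀..t, F (u s) (w s) := by
  obtain ⟨ρ₀, hρ₀, hball⟩ := Metric.nhds_basis_closedBall.mem_iff.1 (hO.mem_nhds hL)
  obtain ⟨ρ, hρ, hρr, hρ1⟩ : ∃ ρ, 0 < ρ ∧ ρ ≤ r ∧ ρ ≤ ρ₀ :=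
    ⟨min r ρ₀, lt_min hr hρ₀, min_le_left _ _, min_le_right _ _⟩
  have hballO : ∀ x ∈ Metric.closedBall L ρ, x ∈ O := fun x hx =>
    hball (Metric.closedBall_subset_closedBall hρ1 hx)
  have hii : ∀ (f : ℝ → ℝ), IntegrableOn f (Icc 0 T) →
      ∀ a ∈ Icc T₀ T, ∀ b ∈ Icc T₀ T, IntervalIntegrable f volume a b :=
    fun f hf a ha b hb => hii_aux h0 f hf a ha b hb
  have hT₀' : T₀ ∈ Icc T₀ T := left_mem_Icc.2 hT₀.le
  have small : ∀ f : ℝ → ℝ, IntegrableOn f (Icc 0 T) → ∀ c > 0,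
      ∀ᶠ t in 𝓝[>] T₀, ∫ s in T₀..t, f s < c := by
    intro f hf c hc
    have hcont := intervalIntegral.continuousOn_primitive_interval'
      (hii f hf T₀ hT₀' T (right_mem_Icc.2 hT₀.le)) left_mem_uIcc
    rw [uIcc_of_le hT₀.le] at hcont
    have := ((hcont T₀ hT₀').mono_of_mem_nhdsWithin
      (s := Ioi T₀) (mem_of_superset (Ioc_mem_nhdsGT hT₀) Ioc_subset_Icc_self)).tendsto
    apply this.eventually_lt_const
    simpa using hc
  have hM : 0 < 1 + (‖L‖ + ρ) := by positivity
  obtain ⟨T₁, ⟨hs1, hs2⟩, hT01, hT1⟩ := (((small _ hγint (ρ / (1 + (‖L‖ + ρ))) (by positivity)).and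
    (small _ hγlint (1/2) (by norm_num))).and (Ioc_mem_nhdsGT hT₀)).exists
  have hle : T₀ ≤ T₁ := hT01.le
  have hsub : Icc T₀ T₁ ⊆ Icc T₀ T := Icc_subset_Icc_right hT1
  let X := C(Icc T₀ T₁, Metric.closedBall L ρ)
  have : CompleteSpace (Metric.closedBall L ρ) := Metric.isClosed_closedBall.completeSpace_coe
  let e : X → ℝ → 𝔹 := fun f t => (f (projIcc T₀ T₁ hle t) : 𝔹)
  have hec : ∀ f : X, Continuous (e f) := fun f =>
    continuous_subtype_val.comp (f.continuous.comp continuous_projIcc)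
  have heB : ∀ (f : X) t, e f t ∈ Metric.closedBall L ρ := fun f t => (f _).2
  have heO : ∀ (f : X) t, e f t ∈ O := fun f t => hballO _ (heB f t)
  have heN : ∀ (f : X) t, ‖e f t‖ ≤ ‖L‖ + ρ := by
    intro f t
    have := heB f t
    rw [mem_closedBall_iff_norm] at this
    have := norm_le_insert' (e f t) L
    linarith
  have hFb : ∀ (f : X) s, ‖F (u s) (e f s)‖ ≤ γ (u s) * (1 + (‖L‖ + ρ)) := by
    intro f s
    refine (hgrowth _ _ (heO f s)).trans ?_
    have := heN f s
    have := (hγ (u s)).le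
    gcongr
  have hint : ∀ f : X, IntegrableOn (fun s => F (u s) (e f s)) (Icc 0 T) := by
    intro f
    exact Integrable.mono' (hγint.mul_const _) (comp_meas hF hu (hec f) (heO f))
      (Eventually.of_forall (hFb f))
  have hmono : ∀ (g : ℝ → ℝ), IntegrableOn g (Icc 0 T) → (∀ s, 0 ≤ g s) → ∀ t ∈ Icc T₀ T₁,
      ∫ s in T₀..t, g s ≤ ∫ s in T₀..T₁, g s := by
    intro g hg hg0 t ht
    exact intervalIntegral.integral_mono_interval le_rfl ht.1 ht.2 (Eventually.of_forall hg0)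
      (hii g hg T₀ hT₀' T₁ (hsub (right_mem_Icc.2 hle)))
  have hmem : ∀ (f : X) (t : Icc T₀ T₁),
      L + ∫ s in T₀..(t:ℝ), F (u s) (e f s) ∈ Metric.closedBall L ρ := by
    intro f t
    rw [mem_closedBall_iff_norm, add_sub_cancel_left]
    refine (intervalIntegral.norm_integral_le_of_norm_le t.2.1
      (Eventually.of_forall fun s _ => hFb f s)
      (hii _ (hγint.mul_const _) T₀ hT₀' t (hsub t.2))).trans ?_
    rw [intervalIntegral.integral_mul_const]
    have h1 := hmono _ hγint (fun s => (hγ _).le) t t.2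
    have h2 := h1.trans hs1.le
    rwa [le_div_iff₀ hM] at h2
  have hcont : ∀ f : X, Continuous fun t : Icc T₀ T₁ => L + ∫ s in T₀..(t:ℝ), F (u s) (e f s) := by
    intro f
    have := intervalIntegral.continuousOn_primitive_interval'
      (hii_aux h0 _ (hint f) T₀ hT₀' T₁ (hsub (right_mem_Icc.2 hle))) left_mem_uIcc
    rw [uIcc_of_le hle] at this
    exact continuous_const.add (continuousOn_iff_continuous_restrict.1 this)
  let Φ : X → X := fun f => ⟨fun t => ⟨_, hmem f t⟩, (hcont f).subtype_mk _⟩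
  have hΦ : ContractingWith (1/2) Φ := by
    refine ⟨by rw [← NNReal.coe_lt_coe]; norm_num, LipschitzWith.of_dist_le_mul fun f g => ?_⟩
    rw [ContinuousMap.dist_le (by positivity)]
    intro t
    change dist (L + ∫ s in T₀..(t:ℝ), F (u s) (e f s)) (L + ∫ s in T₀..(t:ℝ), F (u s) (e g s)) ≤ _
    rw [dist_eq_norm, add_sub_add_left_eq_sub, ← intervalIntegral.integral_sub
      (hii_aux h0 _ (hint f) T₀ hT₀' t (hsub t.2)) (hii_aux h0 _ (hint g) T₀ hT₀' t (hsub t.2))]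
    refine (intervalIntegral.norm_integral_le_of_norm_le (g := fun s => γl (u s) * dist f g) t.2.1
      (Eventually.of_forall fun s _ => ?_)
      (hii _ (hγlint.mul_const _) T₀ hT₀' t (hsub t.2))).trans ?_
    · refine (hlip (u s) _ (heO f s) _ (heO g s)
        ((mem_closedBall_iff_norm.1 (heB f s)).trans hρr)
        ((mem_closedBall_iff_norm.1 (heB g s)).trans hρr)).trans ?_
      refine mul_le_mul_of_nonneg_left ?_ (hγl _).le
      rw [← dist_eq_norm]
      exact ContinuousMap.dist_apply_le_dist (f := f) (g := g) _
    · rw [intervalIntegral.integral_mul_const]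
      have h1 := (hmono _ hγlint (fun s => (hγl _).le) t t.2).trans hs2.le
      refine mul_le_mul_of_nonneg_right (h1.trans (by norm_num)) dist_nonneg
  have : Nonempty X := ⟨ContinuousMap.const _ ⟨L, Metric.mem_closedBall_self hρ.le⟩⟩
  obtain ⟨f, hf⟩ : ∃ f : X, Φ f = f := ⟨_, hΦ.fixedPoint_isFixedPt⟩
  refine ⟨T₁, hT01, hT1, e f, hec f, heO f,
    hii_aux h0 _ (hint f) T₀ hT₀' T₁ (hsub (right_mem_Icc.2 hle)), fun t ht => ?_⟩
  have h1 : e f t = (f ⟨t, ht⟩ : 𝔹) := by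
    simp only [e]
    rw [projIcc_of_mem hle ht]
  have h2 : ((Φ f) ⟨t, ht⟩ : 𝔹) = L + ∫ s in T₀..t, F (u s) (e f s) := rfl
  rw [h1, ← h2, hf]

/-- **Theorem 7.1 (controlled ODE: a priori bound and behavior at the maximal time).**
If `y` is a solution of the controlled ODE on a maximal interval `[0,T₀)` with
`T₀ ≤ T`, then (1) `sup_{t<T₀} ‖y(t)‖ ≤ (‖y₀‖ + ∫₀ᵀ γ(u)) exp(∫₀ᵀ γ(u))`,
(2) `y(t)` converges in `𝔹` as `t → T₀`, and (3) if `T₀ < T` the limit is not in `O`. -/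
theorem controlled_ode_maximal_solution_properties
    {𝔹 : Type*} [NormedAddCommGroup 𝔹] [NormedSpace ℝ 𝔹] [CompleteSpace 𝔹]
    {U : Type*} [MetricSpace U]
    (O : Set 𝔹) (hO : IsOpen O)
    (F : U → 𝔹 → 𝔹)
    (hF : ContinuousOn (fun p : U × 𝔹 => F p.1 p.2) (univ ×ˢ O))
    (γ : U → ℝ) (hγ : ∀ u : U, 0 < γ u)
    (hgrowth : ∀ u : U, ∀ y ∈ O, ‖F u y‖ ≤ γ u * (1 + ‖y‖))
    (r : 𝔹 → ℝ) (γloc : 𝔹 → U → ℝ)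
    (hr : ∀ y₀ ∈ O, 0 < r y₀)
    (hγloc : ∀ y₀ ∈ O, ∀ u : U, 0 < γloc y₀ u)
    (hlip : ∀ y₀ ∈ O, ∀ u : U, ∀ y ∈ O, ∀ y' ∈ O,
      ‖y - y₀‖ ≤ r y₀ → ‖y' - y₀‖ ≤ r y₀ → ‖F u y - F u y'‖ ≤ γloc y₀ u * ‖y - y'‖)
    (T : ℝ) (hT : 0 < T)
    (u : ℝ → U) (hu : Admissible T u)
    (hγint : IntegrableOn (fun t => γ (u t)) (Icc 0 T))
    (hγlocint : ∀ y₀ ∈ O, IntegrableOn (fun t => γloc y₀ (u t)) (Icc 0 T))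
    (y₀ : 𝔹) (hy₀ : y₀ ∈ O)
    (T₀ : ℝ) (hT₀ : T₀ ∈ Ioc (0 : ℝ) T)
    (y : ℝ → 𝔹) (hy : IsSolOn F u O y₀ T₀ y)
    (hmax : ∀ T₁ : ℝ, T₀ < T₁ → T₁ ≤ T →
      ¬∃ z : ℝ → 𝔹, IsSolOn F u O y₀ T₁ z ∧ EqOn z y (Ico 0 T₀)) :
    (∀ t ∈ Ico (0 : ℝ) T₀,
      ‖y t‖ ≤ (‖y₀‖ + ∫ s in (0 : ℝ)..T, γ (u s)) *
        Real.exp (∫ s in (0 : ℝ)..T, γ (u s))) ∧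
    ∃ L : 𝔹, Tendsto y (𝓝[Ico (0 : ℝ) T₀] T₀) (𝓝 L) ∧ (T₀ < T → L ∉ O) := by
  obtain ⟨hyc, hyO, hyi⟩ := hy
  obtain ⟨hT0, hT0T⟩ := hT₀
  have hsubT : ∀ t ∈ Ico (0:ℝ) T₀, t ∈ Icc (0:ℝ) T := fun t ht => ⟨ht.1, ht.2.le.trans hT0T⟩
  have h0T : (0:ℝ) ∈ Icc (0:ℝ) T := ⟨le_rfl, hT.le⟩
  have hγi : ∀ t ∈ Icc (0:ℝ) T, IntervalIntegrable (fun s => γ (u s)) volume 0 t :=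
    fun t ht => hii_aux le_rfl _ hγint 0 h0T t ht
  have hγm : ∀ t ∈ Icc (0:ℝ) T, ∫ s in (0:ℝ)..t, γ (u s) ≤ ∫ s in (0:ℝ)..T, γ (u s) := by
    intro t ht
    exact intervalIntegral.integral_mono_interval le_rfl ht.1 ht.2
      (Eventually.of_forall fun s => (hγ _).le) (hγi T ⟨hT.le, le_rfl⟩)
  have hγ0 : 0 ≤ ∫ s in (0:ℝ)..T, γ (u s) :=
    intervalIntegral.integral_nonneg hT.le fun s _ => (hγ _).le
  have part1 : ∀ t ∈ Ico (0 : ℝ) T₀,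
      ‖y t‖ ≤ (‖y₀‖ + ∫ s in (0 : ℝ)..T, γ (u s)) *
        Real.exp (∫ s in (0 : ℝ)..T, γ (u s)) := by
    intro t ht
    have hsub : Icc 0 t ⊆ Ico (0:ℝ) T₀ := fun s hs => ⟨hs.1, hs.2.trans_lt ht.2⟩
    have hyn : ContinuousOn (fun s => ‖y s‖) (Icc 0 t) := (hyc.mono hsub).norm
    refine (gron_aux t (‖y₀‖ + ∫ s in (0 : ℝ)..T, γ (u s)) (by positivity) (fun s => γ (u s))
      (fun s => ‖y s‖) (fun s => (hγ _).le) hyn (fun s => norm_nonneg _) ht.1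
      (hγi t (hsubT t ht)) ?_).trans ?_
    · intro s hs
      have hs' := hsub hs
      have hγs := hγi s (hsubT s hs')
      have hγys : IntervalIntegrable (fun x => γ (u x) * ‖y x‖) volume 0 s := by
        apply hγs.mul_continuousOn
        rw [uIcc_of_le hs.1]
        exact hyn.mono (Icc_subset_Icc_right hs.2)
      have hb : ‖∫ x in (0:ℝ)..s, F (u x) (y x)‖
          ≤ ∫ x in (0:ℝ)..s, (γ (u x) + γ (u x) * ‖y x‖) := by
        apply intervalIntegral.norm_integral_le_of_norm_le hs.1 _ (hγs.add hγys)
        refine Eventually.of_forall fun x hx => ?_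
        have := hgrowth (u x) (y x) (hyO x (hsub ⟨hx.1.le, hx.2.trans hs.2⟩))
        linarith
      rw [intervalIntegral.integral_add hγs hγys] at hb
      have h1 := norm_add_le y₀ (∫ x in (0:ℝ)..s, F (u x) (y x))
      rw [← (hyi s hs').2] at h1
      have h2 := hγm s (hsubT s hs')
      linarith
    · have := hγm t (hsubT t ht)
      gcongr
  refine ⟨part1, ?_⟩
  set M := (‖y₀‖ + ∫ s in (0 : ℝ)..T, γ (u s)) * Real.exp (∫ s in (0 : ℝ)..T, γ (u s)) with hMdef
  have hM : 0 ≤ M := by positivity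
  have hfint : IntervalIntegrable (fun s => F (u s) (y s)) volume 0 T₀ := by
    rw [intervalIntegrable_iff_integrableOn_Ioc_of_le hT0.le]
    let b : ℕ → ℝ := fun n => T₀ * (1 - 1 / ((n:ℝ) + 1))
    have hbm : ∀ n, b n ∈ Ico (0:ℝ) T₀ := by
      intro n
      have h1 : (0:ℝ) < 1 / ((n:ℝ) + 1) := by positivity
      have h2 : 1 / ((n:ℝ) + 1) ≤ 1 := by
        rw [div_le_one (by positivity)]
        have : (0:ℝ) ≤ n := by positivity
        linarith
      constructor
      · exact mul_nonneg hT0.le (by linarith)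
      · have := mul_pos hT0 h1
        simp only [b]
        linarith
    refine integrableOn_Ioc_of_intervalIntegral_norm_bounded_right (l := atTop) (b := b)
      (I := (∫ s in (0:ℝ)..T, γ (u s)) * (1 + M)) ?_ ?_ ?_
    · intro n
      have := (hyi (b n) (hbm n)).1
      rwa [intervalIntegrable_iff_integrableOn_Ioc_of_le (hbm n).1] at this
    · have := (tendsto_one_div_add_atTop_nhds_zero_nat (𝕜 := ℝ)).const_sub 1 |>.const_mul T₀
      simpa [b] using this
    · refine Eventually.of_forall fun n => ?_
      rw [← intervalIntegral.integral_of_le (hbm n).1]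
      have h1 : ∫ x in (0:ℝ)..(b n), ‖F (u x) (y x)‖ ≤ ∫ x in (0:ℝ)..(b n), γ (u x) * (1 + M) := by
        apply intervalIntegral.integral_mono_on (hbm n).1 (hyi (b n) (hbm n)).1.norm
          ((hγi _ (hsubT _ (hbm n))).mul_const _)
        intro x hx
        have hx' : x ∈ Ico (0:ℝ) T₀ := ⟨hx.1, hx.2.trans_lt (hbm n).2⟩
        refine (hgrowth (u x) (y x) (hyO x hx')).trans ?_
        have := part1 x hx'
        have := (hγ (u x)).le
        gcongr
      rw [intervalIntegral.integral_mul_const] at h1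
      exact h1.trans (mul_le_mul_of_nonneg_right (hγm _ (hsubT _ (hbm n))) (by positivity))
  refine ⟨y₀ + ∫ s in (0:ℝ)..T₀, F (u s) (y s), ?_, ?_⟩
  · have hc := intervalIntegral.continuousOn_primitive_interval' hfint left_mem_uIcc
    rw [uIcc_of_le hT0.le] at hc
    have h1 := (((hc T₀ (right_mem_Icc.2 hT0.le)).mono Ico_subset_Icc_self).tendsto).const_add y₀
    refine h1.congr' ?_
    filter_upwards [self_mem_nhdsWithin] with t ht using (hyi t ht).2.symm
  intro hlt hLO
  set L := y₀ + ∫ s in (0:ℝ)..T₀, F (u s) (y s) with hLdef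
  obtain ⟨T₁, hT01, hT1, w, hwc, hwO, hwi, hw⟩ := local_exist O hO F hF γ hγ hgrowth L hLO (r L)
    (γloc L) (hr L hLO) (hγloc L hLO) (hlip L hLO) T u hu hγint (hγlocint L hLO) T₀ hT0.le hlt
  apply hmax T₁ hT01 hT1
  let z : ℝ → 𝔹 := fun t => if t < T₀ then y t else w t
  have hz1 : ∀ t < T₀, z t = y t := fun t ht => if_pos ht
  have hz2 : ∀ t, T₀ ≤ t → z t = w t := fun t ht => if_neg (not_lt.2 ht)
  have hzi1 : IntervalIntegrable (fun s => F (u s) (z s)) volume 0 T₀ := by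
    refine hfint.congr_ae ?_
    rw [uIoc_of_le hT0.le]
    filter_upwards [ae_restrict_mem measurableSet_Ioc,
      ae_restrict_of_ae (Measure.ae_ne volume T₀)] with s hs hne
    rw [hz1 s (lt_of_le_of_ne hs.2 hne)]
  have hzi2 : IntervalIntegrable (fun s => F (u s) (z s)) volume T₀ T₁ := by
    refine hwi.congr_ae ?_
    rw [uIoc_of_le hT01.le]
    filter_upwards [ae_restrict_mem measurableSet_Ioc] with s hs
    rw [hz2 s hs.1.le]
  have hzi : IntervalIntegrable (fun s => F (u s) (z s)) volume 0 T₁ := hzi1.trans hzi2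
  have hT1p : 0 ≤ T₁ := hT0.le.trans hT01.le
  have hzeq1 : ∀ t ∈ Icc 0 T₀, ∫ s in (0:ℝ)..t, F (u s) (z s) = ∫ s in (0:ℝ)..t, F (u s) (y s) := by
    intro t ht
    apply intervalIntegral.integral_congr_ae
    filter_upwards [Measure.ae_ne volume T₀] with s hne hs
    rw [uIoc_of_le ht.1] at hs
    rw [hz1 s (lt_of_le_of_ne (hs.2.trans ht.2) hne)]
  have hzeq : ∀ t ∈ Icc 0 T₁, z t = y₀ + ∫ s in (0:ℝ)..t, F (u s) (z s) := by
    intro t ht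
    rcases lt_or_ge t T₀ with h | h
    · rw [hz1 t h, hzeq1 t ⟨ht.1, h.le⟩]
      exact (hyi t ⟨ht.1, h⟩).2
    · rw [hz2 t h, hw t ⟨h, ht.2⟩, ← intervalIntegral.integral_add_adjacent_intervals hzi1
        (hzi2.mono_set (by
          rw [uIcc_of_le h, uIcc_of_le hT01.le]
          exact Icc_subset_Icc_right ht.2)), hzeq1 T₀ ⟨hT0.le, le_rfl⟩, ← add_assoc, ← hLdef]
      congr 1
      apply intervalIntegral.integral_congr
      intro s hs
      rw [uIcc_of_le h] at hs
      simp only [hz2 s hs.1]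
  refine ⟨z, ⟨?_, ?_, ?_⟩, fun t ht => hz1 t ht.2⟩
  · have hc := intervalIntegral.continuousOn_primitive_interval' hzi left_mem_uIcc
    rw [uIcc_of_le hT1p] at hc
    exact ((continuousOn_const.add hc).congr hzeq).mono Ico_subset_Icc_self
  · intro t ht
    rcases lt_or_ge t T₀ with h | h
    · rw [hz1 t h]; exact hyO t ⟨ht.1, h⟩
    · rw [hz2 t h]; exact hwO t
  · intro t ht
    refine ⟨hzi.mono_set ?_, hzeq t (Ico_subset_Icc_self ht)⟩
    rw [uIcc_of_le ht.1, uIcc_of_le hT1p]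
    exact Icc_subset_Icc_right ht.2.le

end
end

section
/- Let v : ℝ³ → ℝ³ be continuously differentiable with v and Dv bounded and tending to 0 at infinity (v ∈ C₀¹(ℝ³,ℝ³)), and let φ be a C¹ diffeomorphism of ℝ³ with φ − id ∈ C₀¹(ℝ³,ℝ³). Then v ∘ φ ∈ C₀¹(ℝ³,ℝ³) and ‖v ∘ φ‖_{1,∞} ≤ (2 + ‖φ − id‖_{1,∞}) ‖v‖_{1,∞}. -/
open MeasureTheory Filter Set
open scoped Topology

noncomputable section

/-- Euclidean 3-space. -/
abbrev E3 : Type := EuclideanSpace ℝ (Fin 3)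

/-- The supremum over `ℝ³` of the norm of the `k`-th derivative of `v`. -/
def supDeriv (k : ℕ) (v : E3 → E3) : ℝ := ⨆ x : E3, ‖iteratedFDeriv ℝ k v x‖

/-- The norm `‖v‖_{s,∞} = Σ_{k ≤ s} sup_x |Dᵏ v(x)|`. -/
def normS (s : ℕ) (v : E3 → E3) : ℝ := ∑ k ∈ Finset.range (s + 1), supDeriv k v

/-- Membership in `C₀^s(ℝ³,ℝ³)`: `v` is `C^s` and all derivatives up to order `s`
tend to `0` at infinity. -/
def MemC0 (s : ℕ) (v : E3 → E3) : Prop :=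
  ContDiff ℝ s v ∧
    ∀ k ≤ s, Tendsto (fun x => ‖iteratedFDeriv ℝ k v x‖) (cocompact E3) (𝓝 0)

/-- `Diff_id^s(ℝ³)`: `C^s`-diffeomorphisms of `ℝ³` equal to the identity at infinity. -/
structure DiffId (s : ℕ) : Type where
  toFun : E3 → E3
  invFun : E3 → E3
  left_inv : Function.LeftInverse invFun toFun
  right_inv : Function.RightInverse invFun toFun
  memC0 : MemC0 s fun x => toFun x - x
  memC0_inv : MemC0 s fun x => invFun x - x

instance (s : ℕ) : CoeFun (DiffId s) fun _ => E3 → E3 := ⟨DiffId.toFun⟩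

theorem bdd_aux {f : E3 → ℝ} (hf : Continuous f) (h : Tendsto f (cocompact E3) (𝓝 0)) :
    BddAbove (range f) := by
  have := (ZeroAtInftyContinuousMap.mk ⟨f, hf⟩ h : ZeroAtInftyContinuousMap E3 ℝ).isBounded_range
  exact this.bddAbove

theorem le_sup_aux {s k : ℕ} (hk : k ≤ s) {v : E3 → E3} (hv : MemC0 s v) (x : E3) :
    ‖iteratedFDeriv ℝ k v x‖ ≤ supDeriv k v := by
  refine le_ciSup (f := fun x => ‖iteratedFDeriv ℝ k v x‖) (bdd_aux ?_ (hv.2 k hk)) x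
  exact (hv.1.continuous_iteratedFDeriv (by exact_mod_cast hk)).norm

theorem sup_nonneg_aux (k : ℕ) (v : E3 → E3) : 0 ≤ supDeriv k v :=
  Real.iSup_nonneg fun _ => norm_nonneg _

theorem contDiff_aux {s : ℕ} {f : E3 → E3} (h : MemC0 s fun x => f x - x) : ContDiff ℝ s f := by
  have := h.1.add contDiff_id
  convert this using 1
  ext1 x
  simp

/-- **Lemma 7.2(i)**: for `v ∈ C₀¹(ℝ³,ℝ³)` and `φ ∈ Diff_id^1(ℝ³)`, one has
`v ∘ φ ∈ C₀¹(ℝ³,ℝ³)` and `‖v ∘ φ‖_{1,∞} ≤ (2 + ‖φ − id‖_{1,∞}) ‖v‖_{1,∞}`. -/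
theorem composition_C01_estimate (v : E3 → E3) (hv : MemC0 1 v) (φ : DiffId 1) :
    MemC0 1 (fun x => v (φ x)) ∧
      normS 1 (fun x => v (φ x)) ≤ (2 + normS 1 fun x => φ x - x) * normS 1 v := by
  have hφ : ContDiff ℝ 1 φ.toFun := contDiff_aux φ.memC0
  have hφi : ContDiff ℝ 1 φ.invFun := contDiff_aux φ.memC0_inv
  have hv1 : ContDiff ℝ 1 v := hv.1
  let e : E3 ≃ₜ E3 :=
    { toFun := φ.toFun, invFun := φ.invFun, left_inv := φ.left_inv, right_inv := φ.right_inv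
      continuous_toFun := hφ.continuous, continuous_invFun := hφi.continuous }
  have ht : Tendsto φ.toFun (cocompact E3) (cocompact E3) := e.isClosedEmbedding.tendsto_cocompact
  set A0 := supDeriv 0 v with hA0
  set A1 := supDeriv 1 v with hA1
  set B0 := supDeriv 0 (fun x => φ x - x) with hB0
  set B1 := supDeriv 1 (fun x => φ x - x) with hB1
  have a0 : 0 ≤ A0 := sup_nonneg_aux _ _
  have a1 : 0 ≤ A1 := sup_nonneg_aux _ _
  have b0 : 0 ≤ B0 := sup_nonneg_aux _ _
  have b1 : 0 ≤ B1 := sup_nonneg_aux _ _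
  have hD : ∀ x, ‖fderiv ℝ φ.toFun x‖ ≤ 1 + B1 := by
    intro x
    have h1 : fderiv ℝ (fun x => φ.toFun x - x) x
        = fderiv ℝ φ.toFun x - ContinuousLinearMap.id ℝ E3 :=
      ((hφ.differentiable one_ne_zero x).hasFDerivAt.sub (hasFDerivAt_id x)).fderiv
    have h2 := le_sup_aux le_rfl φ.memC0 x
    rw [norm_iteratedFDeriv_one, h1] at h2
    have h3 := norm_add_le (fderiv ℝ φ.toFun x - ContinuousLinearMap.id ℝ E3)
      (ContinuousLinearMap.id ℝ E3)
    rw [sub_add_cancel] at h3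
    have h4 : ‖ContinuousLinearMap.id ℝ E3‖ ≤ 1 := ContinuousLinearMap.norm_id_le
    linarith
  have hC : ∀ x, ‖iteratedFDeriv ℝ 1 (fun x => v (φ x)) x‖
      ≤ ‖iteratedFDeriv ℝ 1 v (φ x)‖ * (1 + B1) := by
    intro x
    have h1 : fderiv ℝ (fun x => v (φ.toFun x)) x
        = (fderiv ℝ v (φ.toFun x)).comp (fderiv ℝ φ.toFun x) :=
      fderiv_comp x (hv1.differentiable one_ne_zero _) (hφ.differentiable one_ne_zero x)
    rw [norm_iteratedFDeriv_one, norm_iteratedFDeriv_one, h1]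
    exact (ContinuousLinearMap.opNorm_comp_le _ _).trans
      (mul_le_mul_of_nonneg_left (hD x) (norm_nonneg _))
  refine ⟨⟨hv1.comp hφ, ?_⟩, ?_⟩
  · intro k hk
    interval_cases k
    · have := (hv.2 0 (by norm_num)).comp ht
      simpa [Function.comp_def] using this
    · have := ((hv.2 1 le_rfl).comp ht).mul_const (1 + B1)
      rw [zero_mul] at this
      exact squeeze_zero (fun _ => norm_nonneg _) hC this
  · have e0 : supDeriv 0 (fun x => v (φ x)) ≤ A0 := by
      refine ciSup_le fun x => ?_
      have := le_sup_aux (Nat.zero_le 1) hv (φ x)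
      rw [norm_iteratedFDeriv_zero] at this ⊢
      exact this
    have e1 : supDeriv 1 (fun x => v (φ x)) ≤ A1 * (1 + B1) := by
      refine ciSup_le fun x => (hC x).trans ?_
      exact mul_le_mul_of_nonneg_right (le_sup_aux le_rfl hv _) (by linarith)
    simp only [normS, Finset.sum_range_succ, Finset.sum_range_zero, zero_add]
    rw [← hA0, ← hA1, ← hB0, ← hB1]
    nlinarith [mul_nonneg a0 b0, mul_nonneg a0 b1, mul_nonneg a1 b0]

end
end

section
/- Let A : Diff_id^1(ℝ³) → 𝓛(V,V*) assign to each φ a bounded symmetric nonnegative operator A_φ, let ω > 0, and for j ∈ V* and φ ∈ Diff_id^1(ℝ³) set v_{φ,j} = (ω K_V⁻¹ + A_φ)⁻¹ j and F(j,φ) = v_{φ,j} ∘ φ. Then F(j,φ) ∈ C₀¹(ℝ³,ℝ³) and ‖F(j,φ)‖_{1,∞} ≤ (c_V/ω)(2 + ‖φ − id‖_{1,∞}) ‖j‖_{V*}. -/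
open MeasureTheory Filter Set
open scoped RealInnerProductSpace Topology

noncomputable section

/-- The seminorm `‖v‖_{1,∞}^Ω = sup_{x ∈ Ω} |v(x)| + sup_{x ∈ Ω} |Dv(x)|`. -/
def normSOn (Ω : Set E3) (v : E3 → E3) : ℝ :=
  (⨆ x : Ω, ‖v (x : E3)‖) + ⨆ x : Ω, ‖fderiv ℝ v (x : E3)‖

/-- The distance `‖φ − ψ‖_{s,∞}` on `Diff_id^s(ℝ³)`. -/
def distS (s : ℕ) (φ ψ : DiffId s) : ℝ := normS s fun x => φ x - ψ x

/-- The set `𝔖_γ = {φ : ‖φ − id‖_{1,∞} ≤ γ and ‖φ⁻¹ − id‖_{1,∞} ≤ γ}`. -/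
def Sgamma (γ : ℝ) : Set (DiffId 1) :=
  {φ | normS 1 (fun x => φ x - x) ≤ γ ∧ normS 1 (fun x => φ.invFun x - x) ≤ γ}

/-- `v` is the velocity `(ω K_V⁻¹ + B)⁻¹ j`, i.e. the unique minimizer of
`(ω/2)‖·‖² + (1/2)(B · | ·) − (j | ·)`:  `ω⟪v,w⟫ + (Bv|w) = (j|w)` for all `w`. -/
def IsVel {V : Type*} [NormedAddCommGroup V] [InnerProductSpace ℝ V]
    (B : V →L[ℝ] V →L[ℝ] ℝ) (ω : ℝ) (j : V →L[ℝ] ℝ) (v : V) : Prop :=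
  ∀ w : V, ω * ⟪v, w⟫ + B v w = j w

/-- `(φ, v)` solves the control system
`φ(t) = id + ∫₀ᵗ v(s) ∘ φ(s) ds`, `v(s) = (ω K_V⁻¹ + A_{φ(s)})⁻¹ j(s)` on `[0,T₀]`,
with `t ↦ φ(t)` continuous into `Diff_id¹(ℝ³)`. -/
def IsSolution {V : Type*} [NormedAddCommGroup V] [InnerProductSpace ℝ V]
    (emb : V →ₗ[ℝ] (E3 → E3)) (ω : ℝ) (A : DiffId 1 → V →L[ℝ] V →L[ℝ] ℝ)
    (j : ℝ → V →L[ℝ] ℝ) (T₀ : ℝ) (φ : ℝ → DiffId 1) (v : ℝ → V) : Prop :=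
  (∀ t ∈ Icc (0 : ℝ) T₀, IsVel (A (φ t)) ω (j t) (v t)) ∧
  (∀ t ∈ Icc (0 : ℝ) T₀, ∀ x : E3,
    IntervalIntegrable (fun s => emb (v s) (φ s x)) volume 0 t ∧
      φ t x = x + ∫ s in (0 : ℝ)..t, emb (v s) (φ s x)) ∧
  ∀ t₀ ∈ Icc (0 : ℝ) T₀,
    Tendsto (fun t => distS 1 (φ t) (φ t₀)) (𝓝[Icc (0 : ℝ) T₀] t₀) (𝓝 0)

lemma aux_bdd (f : E3 → ℝ) (hf : Continuous f) (h : Tendsto f (cocompact E3) (𝓝 0)) :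
    BddAbove (range f) := by
  have h1 : ∀ᶠ x in cocompact E3, f x < 1 := h.eventually (gt_mem_nhds one_pos)
  obtain ⟨K, hK, hKs⟩ := mem_cocompact.1 h1
  obtain ⟨M, hM⟩ := (hK.image hf).bddAbove
  refine ⟨max M 1, ?_⟩
  rintro _ ⟨x, rfl⟩
  by_cases hx : x ∈ K
  · exact le_max_of_le_left (hM ⟨x, hx, rfl⟩)
  · exact le_max_of_le_right (le_of_lt (hKs hx))

lemma aux_le (s k : ℕ) (hk : k ≤ s) (f : E3 → E3) (hf : MemC0 s f) (x : E3) :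
    ‖iteratedFDeriv ℝ k f x‖ ≤ supDeriv k f := by
  have hc : Continuous (iteratedFDeriv ℝ k f) :=
    hf.1.continuous_iteratedFDeriv (by exact_mod_cast hk)
  exact le_ciSup (aux_bdd _ hc.norm (hf.2 k hk)) x

lemma aux_nonneg (k : ℕ) (f : E3 → E3) : 0 ≤ supDeriv k f :=
  Real.iSup_nonneg fun _ => norm_nonneg _

lemma aux_contDiff (φ : E3 → E3) (h : MemC0 1 fun x => φ x - x) : ContDiff ℝ 1 φ := by
  have h1 : ContDiff ℝ 1 (fun x => φ x - x) := by exact_mod_cast h.1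
  have := h1.add contDiff_id
  simpa using this

/-- **Corollary 7.3 (bound on `F(j,φ) = v_{φ,j} ∘ φ`).**
If `v_{φ,j} = (ω K_V⁻¹ + A_φ)⁻¹ j`, then `v_{φ,j} ∘ φ ∈ C₀¹(ℝ³,ℝ³)` and
`‖v_{φ,j} ∘ φ‖_{1,∞} ≤ (c_V/ω)(2 + ‖φ − id‖_{1,∞}) ‖j‖_{V*}`. -/
theorem velocity_composition_bound
    {V : Type*} [NormedAddCommGroup V] [InnerProductSpace ℝ V] [CompleteSpace V]
    [TopologicalSpace.SeparableSpace V]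
    (emb : V →ₗ[ℝ] (E3 → E3)) (cV : ℝ) (hcV : 0 < cV)
    (hembC0 : ∀ u : V, MemC0 2 (emb u))
    (hembBound : ∀ u : V, normS 2 (emb u) ≤ cV * ‖u‖)
    (ω : ℝ) (hω : 0 < ω)
    (A : DiffId 1 → V →L[ℝ] V →L[ℝ] ℝ)
    (hAsymm : ∀ (φ : DiffId 1) (u w : V), A φ u w = A φ w u)
    (hApos : ∀ (φ : DiffId 1) (u : V), 0 ≤ A φ u u)
    (j : V →L[ℝ] ℝ) (φ : DiffId 1) (v : V) (hv : IsVel (A φ) ω j v) :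
    MemC0 1 (fun x => emb v (φ x)) ∧
      normS 1 (fun x => emb v (φ x)) ≤
        cV / ω * (2 + normS 1 fun x => φ x - x) * ‖j‖ := by
  have hu := hembC0 v
  have hφ := aux_contDiff _ φ.memC0
  have hφi := aux_contDiff _ φ.memC0_inv
  have hu2 : ContDiff ℝ 2 (emb v) := by exact_mod_cast hu.1
  have hu1 : ContDiff ℝ 1 (emb v) := hu2.of_le (by norm_num)
  have hF : ContDiff ℝ 1 (fun x => emb v (φ x)) := hu1.comp hφ
  let e : E3 ≃ₜ E3 :=
    { toFun := φ.toFun, invFun := φ.invFun, left_inv := φ.left_inv, right_inv := φ.right_inv,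
      continuous_toFun := hφ.continuous, continuous_invFun := hφi.continuous }
  have hcc : Tendsto φ.toFun (cocompact E3) (cocompact E3) :=
    e.isClosedEmbedding.tendsto_cocompact
  set N := supDeriv 1 (fun x => φ x - x) with hN
  have hN0 : 0 ≤ N := aux_nonneg _ _
  have hg0 : 0 ≤ supDeriv 0 (fun x => φ x - x) := aux_nonneg _ _
  have hS0 : 0 ≤ supDeriv 0 (emb v) := aux_nonneg _ _
  have hS1 : 0 ≤ supDeriv 1 (emb v) := aux_nonneg _ _
  have hS2 : 0 ≤ supDeriv 2 (emb v) := aux_nonneg _ _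
  have hDφ : ∀ x, ‖fderiv ℝ φ.toFun x‖ ≤ 1 + N := by
    intro x
    have hd : DifferentiableAt ℝ φ.toFun x := hφ.differentiable (by norm_num) x
    have h1 := aux_le 1 1 le_rfl _ φ.memC0 x
    rw [norm_iteratedFDeriv_one, fderiv_fun_sub hd differentiableAt_fun_id, fderiv_id'] at h1
    calc ‖fderiv ℝ φ.toFun x‖
        = ‖ContinuousLinearMap.id ℝ E3 + (fderiv ℝ φ.toFun x - ContinuousLinearMap.id ℝ E3)‖ := by
          congr 1; abel
      _ ≤ _ := (norm_add_le _ _).trans (add_le_add ContinuousLinearMap.norm_id_le h1)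
  have h0 : ∀ x, ‖iteratedFDeriv ℝ 0 (fun x => emb v (φ x)) x‖
      = ‖iteratedFDeriv ℝ 0 (emb v) (φ x)‖ := by
    intro x; simp
  have h1 : ∀ x, ‖iteratedFDeriv ℝ 1 (fun x => emb v (φ x)) x‖
      ≤ ‖iteratedFDeriv ℝ 1 (emb v) (φ x)‖ * (1 + N) := by
    intro x
    rw [norm_iteratedFDeriv_one, norm_iteratedFDeriv_one]
    have hc := fderiv_comp x (hu1.differentiable (by norm_num) (φ.toFun x))
      (hφ.differentiable (by norm_num) x)
    have hc' : fderiv ℝ (fun x => emb v (φ x)) x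
      = (fderiv ℝ (emb v) (φ x)).comp (fderiv ℝ φ.toFun x) := hc
    rw [hc']
    exact (ContinuousLinearMap.opNorm_comp_le _ _).trans
      (mul_le_mul_of_nonneg_left (hDφ x) (norm_nonneg _))
  refine ⟨⟨by exact_mod_cast hF, ?_⟩, ?_⟩
  · intro k hk
    have hk' : k = 0 ∨ k = 1 := by omega
    rcases hk' with rfl | rfl
    · simp_rw [h0]
      exact (hu.2 0 (by norm_num)).comp hcc
    · refine squeeze_zero (fun _ => norm_nonneg _) h1 ?_
      simpa using ((hu.2 1 (by norm_num)).comp hcc).mul_const (1 + N)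
  · have hvn : ω * ‖v‖ ≤ ‖j‖ := by
      have h2 := hv v
      rw [real_inner_self_eq_norm_sq] at h2
      have h3 := hApos φ v
      have h4 : j v ≤ ‖j‖ * ‖v‖ := (le_abs_self _).trans (j.le_opNorm v)
      rcases (norm_nonneg v).eq_or_lt with h5 | h5
      · rw [← h5]; simp
      · refine le_of_mul_le_mul_right ?_ h5
        nlinarith
    have hv2 : ‖v‖ ≤ ‖j‖ / ω := by
      rw [le_div_iff₀ hω]; linarith
    have b0 : supDeriv 0 (fun x => emb v (φ x)) ≤ supDeriv 0 (emb v) :=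
      ciSup_le fun x => (h0 x).le.trans (aux_le 2 0 (by norm_num) _ hu _)
    have b1 : supDeriv 1 (fun x => emb v (φ x)) ≤ supDeriv 1 (emb v) * (1 + N) :=
      ciSup_le fun x => (h1 x).trans
        (mul_le_mul_of_nonneg_right (aux_le 2 1 (by norm_num) _ hu _) (by linarith))
    have hb := hembBound v
    simp only [normS, Finset.sum_range_succ, Finset.sum_range_zero, zero_add] at hb ⊢
    rw [← hN]
    set G := supDeriv 0 (fun x => φ x - x)
    have hb2 : supDeriv 0 (emb v) + supDeriv 1 (emb v) ≤ cV / ω * ‖j‖ := by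
      have := mul_le_mul_of_nonneg_left hv2 hcV.le
      have e1 : cV * (‖j‖ / ω) = cV / ω * ‖j‖ := by ring
      linarith
    calc _ ≤ supDeriv 0 (emb v) + supDeriv 1 (emb v) * (1 + N) := add_le_add b0 b1
      _ ≤ (supDeriv 0 (emb v) + supDeriv 1 (emb v)) * (2 + (G + N)) := by
        have := mul_nonneg hS0 hN0
        have := mul_nonneg hS0 hg0
        have := mul_nonneg hS1 hg0
        nlinarith
      _ ≤ (cV / ω * ‖j‖) * (2 + (G + N)) :=
        mul_le_mul_of_nonneg_right hb2 (by linarith)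
      _ = _ := by ring

end
end
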